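/- Vitushkin-type lower bound in the L¹ norm with explicit constant: let s ≥ 1 be an integer, l = m + α with m ∈ ℕ and 0 < α ≤ 1, and let n ≥ 1, d ≥ 2 be integers. Let P(x,ζ) = Σ_{|k| ≤ d} c_k(x) ζ^k be any family of functions on I^s parametrized polynomially by ζ ∈ ℝⁿ of degree at most d, with coefficients c_k ∈ L¹(I^s). Then there exists h ∈ Λ_l(I^s) such that for every ζ ∈ ℝⁿ one has ‖h − P(·,ζ)‖_{L¹(I^s)} ≥ C_{L¹}(l,s) / (n·log d)^{l/s}, where C_{L¹}(l,s) = ((m+1)!)^{2s} / ( 5√s · 2^{l+2} · 18^{l/s} · (m+1)^{m+1} · ((2m+3)!)^s · (1+e)^{s(m+1)} ). -/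

import Mathlib

open MeasureTheory Set

noncomputable section

/-- The unit cube `I^s = [0,1]^s` in `ℝ^s` (with the Euclidean norm). -/
def cube (s : ℕ) : Set (EuclideanSpace ℝ (Fin s)) :=
  {x | ∀ i, x i ∈ Icc (0:ℝ) 1}

/-- The Hölder class `Λ_l(I^s)` with `l = m + α`, `0 < α ≤ 1`. -/
def HolderClass (s m : ℕ) (α : ℝ) (f : EuclideanSpace ℝ (Fin s) → ℝ) : Prop :=
  ContDiffOn ℝ m f (cube s) ∧
  (∀ j ≤ m, ∀ x ∈ cube s, ‖iteratedFDerivWithin ℝ j f (cube s) x‖ ≤ 1) ∧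
  ∀ x ∈ cube s, ∀ y ∈ cube s,
    ‖iteratedFDerivWithin ℝ m f (cube s) x - iteratedFDerivWithin ℝ m f (cube s) y‖
      ≤ ‖x - y‖ ^ α

/-- Multi-indices `k ∈ ℕ^n` with `|k| = Σ kᵢ ≤ d`. -/
def degSet (n d : ℕ) : Finset (Fin n → ℕ) :=
  (Fintype.piFinset fun _ => Finset.range (d + 1)).filter fun k => ∑ i, k i ≤ d

/-- The explicit constant
`C_{L¹}(l,s) = ((m+1)!)^{2s} / (5√s · 2^{l+2} · 18^{l/s} · (m+1)^{m+1} · ((2m+3)!)^s ·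
(1+e)^{s(m+1)})`, `l = m + α`. -/
def CL1 (s m : ℕ) (α : ℝ) : ℝ :=
  ((Nat.factorial (m + 1) : ℝ)) ^ (2 * s) /
    (5 * Real.sqrt s * (2:ℝ) ^ ((m:ℝ) + α + 2) * (18:ℝ) ^ (((m:ℝ) + α) / s)
      * ((m:ℝ) + 1) ^ (m + 1) * ((Nat.factorial (2 * m + 3) : ℝ)) ^ s
      * (1 + Real.exp 1) ^ (s * (m + 1)))

/-! ### Linear algebra / combinatorics core -/

lemma weight_exists {X : Type*} [Fintype X] (W : Submodule ℝ (EuclideanSpace ℝ X)) :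
    ∃ w : X → ℝ, (∀ x, 0 ≤ w x) ∧ ∑ x, w x = Module.finrank ℝ W ∧
      ∀ u ∈ W, ∀ x, u x ^ 2 ≤ w x * ∑ y, u y ^ 2 := by
  set f := stdOrthonormalBasis ℝ W with hf
  refine ⟨fun x => ∑ j, ((f j : W) : EuclideanSpace ℝ X) x ^ 2, fun x => by positivity, ?_, ?_⟩
  · rw [Finset.sum_comm]
    have h1 : ∀ j, ∑ x, ((f j : W) : EuclideanSpace ℝ X) x ^ 2 = 1 := by
      intro j
      have := f.orthonormal.1 j
      rw [Submodule.coe_norm, EuclideanSpace.norm_eq, Real.sqrt_eq_one] at this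
      simpa using this
    simp [h1]
  · intro u hu x
    have h2 : u x = ∑ j, f.repr ⟨u, hu⟩ j * ((f j : W) : EuclideanSpace ℝ X) x := by
      have h3 := f.sum_repr ⟨u, hu⟩
      have h4 := congrArg (fun v : W => ((v : W) : EuclideanSpace ℝ X) x) h3
      simp only [Submodule.coe_sum, Submodule.coe_smul] at h4
      rw [← h4]
      simp
    have h5 : ∑ j, f.repr ⟨u, hu⟩ j ^ 2 = ∑ y, u y ^ 2 := by
      have h6 : ‖f.repr ⟨u, hu⟩‖ = ‖u‖ := by
        rw [LinearIsometryEquiv.norm_map]; rfl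
      have h7 := congrArg (fun t => t ^ 2) h6
      simp only [EuclideanSpace.norm_sq_eq] at h7
      simpa using h7
    rw [h2, ← h5, mul_comm]
    exact Finset.sum_mul_sq_le_sq_mul_sq _ _ _

/-- Sign attached to a boolean. -/
def sgn (b : Bool) : ℝ := if b then 1 else -1

lemma poly_eval_eq (n D : ℕ) (q : MvPolynomial (Fin n) ℝ) (hq : q.totalDegree ≤ D) (ζ : Fin n → ℝ) :
    MvPolynomial.eval ζ q = ∑ k ∈ degSet n D,
      (∏ i, ζ i ^ k i) * q.coeff (Finsupp.equivFunOnFinite.symm k) := by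
  rw [MvPolynomial.eval_eq']
  have hsub : q.support.map (Finsupp.equivFunOnFinite.toEmbedding) ⊆ degSet n D := by
    intro k hk
    simp only [Finset.mem_map, Equiv.coe_toEmbedding] at hk
    obtain ⟨a, ha, rfl⟩ := hk
    have h1 := MvPolynomial.le_totalDegree ha
    have h2 : ∑ i, a i ≤ D := by
      rw [Finsupp.sum_fintype _ _ (by simp)] at h1
      omega
    simp only [degSet, Finset.mem_filter, Fintype.mem_piFinset, Finset.mem_range]
    refine ⟨fun i => ?_, h2⟩
    have := Finset.single_le_sum (f := fun i => a i) (fun i _ => Nat.zero_le _) (Finset.mem_univ i)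
    simp only [Finsupp.equivFunOnFinite_apply] at *
    omega
  rw [← Finset.sum_subset hsub, Finset.sum_map]
  · apply Finset.sum_congr rfl
    intro a _
    simp [mul_comm]
  · intro k _ hk
    have : (q.coeff (Finsupp.equivFunOnFinite.symm k)) = 0 := by
      by_contra h
      apply hk
      simp only [Finset.mem_map]
      exact ⟨Finsupp.equivFunOnFinite.symm k, by simpa using h, by simp⟩
    simp [this]

lemma coord_ineq (z : ℝ) :
    2 * (1 + z ^ 2) * (1 / 16 : ℝ) ^ (5 / 8 * |1 - z|) ≤ (1 + z) ^ 2 + 1 / 16 * (1 - z) ^ 2 := by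
  have hz : 0 < 1 + z ^ 2 := by positivity
  set q := (1 - z) ^ 2 / (2 * (1 + z ^ 2)) with hq
  have hq0 : 0 ≤ q := by positivity
  have hq1 : q ≤ 1 := by
    rw [hq, div_le_one (by positivity)]; nlinarith [sq_nonneg (1 + z)]
  have hq2 : q ≤ 5 / 8 * |1 - z| := by
    rw [hq, div_le_iff₀ (by positivity), ← sq_abs (1 - z)]
    have h1 : |1 - z| ≤ 5 / 4 * (1 + z ^ 2) := by
      rw [abs_le]; constructor <;> nlinarith [sq_nonneg (z + 2 / 5), sq_nonneg (z - 2 / 5)]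
    nlinarith [abs_nonneg (1 - z)]
  have h1 : (1 / 16 : ℝ) ^ (5 / 8 * |1 - z|) ≤ (1 / 16 : ℝ) ^ q :=
    Real.rpow_le_rpow_of_exponent_ge (by norm_num) (by norm_num) hq2
  have h2 : (1 / 16 : ℝ) ^ q ≤ (1 - q) + q * (1 / 16) := by
    have := Real.geom_mean_le_arith_mean2_weighted (w₁ := 1 - q) (w₂ := q) (p₁ := 1) (p₂ := 1 / 16)
      (by linarith) hq0 (by norm_num) (by norm_num) (by ring)
    simpa using this
  have h3 : 2 * (1 + z ^ 2) * ((1 - q) + q * (1 / 16)) = (1 + z) ^ 2 + 1 / 16 * (1 - z) ^ 2 := by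
    have : 2 * (1 + z ^ 2) * q = (1 - z) ^ 2 := by rw [hq]; field_simp
    linear_combination (-15 / 16) * this
  rw [← h3]
  exact mul_le_mul_of_nonneg_left (h1.trans h2) (by positivity)

lemma core {ι : Type*} [Fintype ι] [DecidableEq ι] (n d : ℕ) (p : ι → MvPolynomial (Fin n) ℝ)
    (hdeg : ∀ i, (p i).totalDegree ≤ d)
    (hall : ∀ ε : ι → Bool, ∃ ζ : Fin n → ℝ,
      ∑ i, |sgn (ε i) - MvPolynomial.eval ζ (p i)| ≤ (Fintype.card ι : ℝ) / 10) :
    (3 / 2 : ℝ) ^ Fintype.card ι ≤ (degSet n (d * Fintype.card ι)).card := by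
  set M := Fintype.card ι with hM
  let q : (ι → Bool) → MvPolynomial (Fin n) ℝ := fun η => ∏ i, (1 + MvPolynomial.C (sgn (η i)) * p i)
  have hq : ∀ η, (q η).totalDegree ≤ d * M := by
    intro η
    refine (MvPolynomial.totalDegree_finsetProd _ _).trans ?_
    have : ∀ i ∈ Finset.univ, (1 + MvPolynomial.C (sgn (η i)) * p i).totalDegree ≤ d := by
      intro i _
      refine (MvPolynomial.totalDegree_add _ _).trans (max_le (by simp) ?_)
      refine (MvPolynomial.totalDegree_mul _ _).trans ?_
      simpa using hdeg i
    refine (Finset.sum_le_card_nsmul _ _ _ this).trans ?_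
    simp [hM, mul_comm]
  let a : (Fin n → ℕ) → EuclideanSpace ℝ (ι → Bool) := fun k =>
    WithLp.toLp 2 fun η => (q η).coeff (Finsupp.equivFunOnFinite.symm k)
  let W : Submodule ℝ (EuclideanSpace ℝ (ι → Bool)) :=
    Submodule.span ℝ (((degSet n (d * M)).image a : Finset _) : Set (EuclideanSpace ℝ (ι → Bool)))
  have hW : (Module.finrank ℝ W : ℝ) ≤ (degSet n (d * M)).card := by
    have h1 := finrank_span_finset_le_card (R := ℝ) ((degSet n (d * M)).image a)
    have h2 := Finset.card_image_le (s := degSet n (d * M)) (f := a)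
    exact_mod_cast h1.trans h2
  let u : (Fin n → ℝ) → EuclideanSpace ℝ (ι → Bool) := fun ζ =>
    WithLp.toLp 2 fun η => MvPolynomial.eval ζ (q η)
  have hu : ∀ ζ, u ζ ∈ W := by
    intro ζ
    have : u ζ = ∑ k ∈ degSet n (d * M), (∏ i, ζ i ^ k i) • a k := by
      ext η
      simp only [u, a]
      rw [poly_eval_eq n (d * M) (q η) (hq η) ζ]
      simp
    rw [this]
    refine Submodule.sum_mem _ fun k hk => Submodule.smul_mem _ _ (Submodule.subset_span ?_)
    exact Finset.mem_coe.2 (Finset.mem_image_of_mem _ hk)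
  obtain ⟨w, hw0, hwsum, hw⟩ := weight_exists W
  let κ : Bool → Bool → ℝ := fun b b' => if b = b' then 1 else 1 / 16
  have hκ0 : ∀ b b', 0 ≤ κ b b' := by intro b b'; simp only [κ]; split_ifs <;> norm_num
  -- main inequality for each sign vector
  have key : ∀ ε : ι → Bool, (1 / 16 : ℝ) ^ ((M : ℝ) / 16) ≤ ∑ η, (∏ i, κ (ε i) (η i)) * w η := by
    intro ε
    obtain ⟨ζ, hζ⟩ := hall ε
    set y : ι → ℝ := fun i => MvPolynomial.eval ζ (p i) with hy
    have huη : ∀ η, u ζ η = ∏ i, (1 + sgn (η i) * y i) := by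
      intro η; simp [u, q, hy]
    have hS : ∑ η, u ζ η ^ 2 = ∏ i, (2 * (1 + y i ^ 2)) := by
      have := Finset.prod_univ_sum (fun _ : ι => (Finset.univ : Finset Bool))
        (fun i b => (1 + sgn b * y i) ^ 2)
      rw [Fintype.piFinset_univ] at this
      simp_rw [huη, ← Finset.prod_pow]
      rw [← this]
      refine Finset.prod_congr rfl fun i _ => ?_
      simp [sgn]; ring
    have hS' : ∑ η, (∏ i, κ (ε i) (η i)) * u ζ η ^ 2
        = ∏ i, ((1 + sgn (ε i) * y i) ^ 2 + 1 / 16 * (1 - sgn (ε i) * y i) ^ 2) := by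
      have := Finset.prod_univ_sum (fun _ : ι => (Finset.univ : Finset Bool))
        (fun i b => κ (ε i) b * (1 + sgn b * y i) ^ 2)
      rw [Fintype.piFinset_univ] at this
      simp_rw [huη, ← Finset.prod_pow, ← Finset.prod_mul_distrib]
      rw [← this]
      refine Finset.prod_congr rfl fun i _ => ?_
      cases ε i <;> simp [sgn, κ] <;> ring
    have hSpos : 0 < ∑ η, u ζ η ^ 2 := by
      rw [hS]; exact Finset.prod_pos fun i _ => by positivity
    have h1 : (1 / 16 : ℝ) ^ ((M : ℝ) / 16) * ∑ η, u ζ η ^ 2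
        ≤ ∑ η, (∏ i, κ (ε i) (η i)) * u ζ η ^ 2 := by
      rw [hS', hS]
      have h2 : (1 / 16 : ℝ) ^ ((M : ℝ) / 16) ≤ ∏ i, (1 / 16 : ℝ) ^ (5 / 8 * |1 - sgn (ε i) * y i|) := by
        rw [← Real.rpow_sum_of_pos (by norm_num)]
        apply Real.rpow_le_rpow_of_exponent_ge (by norm_num) (by norm_num)
        rw [← Finset.mul_sum]
        have h3 : ∀ i, |1 - sgn (ε i) * y i| = |sgn (ε i) - y i| := by
          intro i
          cases ε i
          · simp only [sgn]; rw [← abs_neg]; congr 1; simp; ring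
          · simp [sgn]
        simp_rw [h3]
        linarith
      calc _ ≤ (∏ i, (1 / 16 : ℝ) ^ (5 / 8 * |1 - sgn (ε i) * y i|)) * ∏ i, (2 * (1 + y i ^ 2)) :=
            mul_le_mul_of_nonneg_right h2 (Finset.prod_nonneg fun i _ => by positivity)
        _ = ∏ i, (2 * (1 + (sgn (ε i) * y i) ^ 2) * (1 / 16 : ℝ) ^ (5 / 8 * |1 - sgn (ε i) * y i|)) := by
            rw [← Finset.prod_mul_distrib]
            refine Finset.prod_congr rfl fun i _ => ?_
            have : sgn (ε i) ^ 2 = 1 := by cases ε i <;> simp [sgn]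
            rw [mul_pow, this]; ring
        _ ≤ _ := Finset.prod_le_prod (fun i _ => by positivity) fun i _ => coord_ineq _
    have h4 : ∑ η, (∏ i, κ (ε i) (η i)) * u ζ η ^ 2
        ≤ (∑ η, (∏ i, κ (ε i) (η i)) * w η) * ∑ η, u ζ η ^ 2 := by
      rw [Finset.sum_mul]
      refine Finset.sum_le_sum fun η _ => ?_
      rw [mul_assoc]
      exact mul_le_mul_of_nonneg_left (hw _ (hu ζ) η) (Finset.prod_nonneg fun i _ => hκ0 _ _)
    exact le_of_mul_le_mul_right (h1.trans h4) hSpos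
  have hsum : ∑ ε : ι → Bool, ∑ η, (∏ i, κ (ε i) (η i)) * w η = (17 / 16) ^ M * ∑ η, w η := by
    rw [Finset.sum_comm, Finset.mul_sum]
    refine Finset.sum_congr rfl fun η _ => ?_
    rw [← Finset.sum_mul]
    congr 1
    have := Finset.prod_univ_sum (fun _ : ι => (Finset.univ : Finset Bool))
        (fun i b => κ b (η i))
    rw [Fintype.piFinset_univ] at this
    rw [← this]
    have h5 : ∀ i, ∑ b, κ b (η i) = 17 / 16 := by
      intro i; cases η i <;> simp [κ] <;> norm_num
    rw [Finset.prod_congr rfl fun i _ => h5 i, Finset.prod_const, Finset.card_univ]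
  have h6 : (2 : ℝ) ^ M * (1 / 16 : ℝ) ^ ((M : ℝ) / 16) ≤ (17 / 16) ^ M * (degSet n (d * M)).card := by
    have h7 := Finset.sum_le_sum (s := Finset.univ) fun ε _ => key ε
    rw [hsum, hwsum] at h7
    have h8 : (∑ _ε : ι → Bool, (1 / 16 : ℝ) ^ ((M : ℝ) / 16)) = 2 ^ M * (1 / 16 : ℝ) ^ ((M : ℝ) / 16) := by
      simp [hM]
    rw [h8] at h7
    exact h7.trans (mul_le_mul_of_nonneg_left hW (by positivity))
  have h9 : (1 / 16 : ℝ) ^ ((M : ℝ) / 16) = ((1 / 16 : ℝ) ^ (1 / 16 : ℝ)) ^ M := by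
    rw [← Real.rpow_natCast, ← Real.rpow_mul (by norm_num)]; congr 1; ring
  have h10 : (51 / 64 : ℝ) ≤ (1 / 16 : ℝ) ^ (1 / 16 : ℝ) := by
    have h11 : (51 / 64 : ℝ) = ((51 / 64 : ℝ) ^ (16 : ℝ)) ^ (1 / 16 : ℝ) := by
      rw [← Real.rpow_mul (by norm_num)]; norm_num
    rw [h11]
    apply Real.rpow_le_rpow (by positivity) _ (by norm_num)
    have : (51 / 64 : ℝ) ^ (16 : ℝ) = (51 / 64 : ℝ) ^ (16 : ℕ) := by
      rw [← Real.rpow_natCast]; norm_num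
    rw [this]; norm_num
  rw [h9, ← mul_pow] at h6
  have h12 : (51 / 32 : ℝ) ^ M ≤ (2 * (1 / 16 : ℝ) ^ (1 / 16 : ℝ)) ^ M :=
    pow_le_pow_left₀ (by norm_num) (by linarith) _
  have h13 : (51 / 32 : ℝ) ^ M = (17 / 16) ^ M * (3 / 2) ^ M := by rw [← mul_pow]; norm_num
  rw [h13] at h12
  exact le_of_mul_le_mul_left (h12.trans h6) (by positivity)

/-! ### Counting bound -/

lemma card_degSet_le (n D : ℕ) (hn : 1 ≤ n) (hD : 1 ≤ D) :
    ((degSet n D).card : ℝ) ≤ (Real.exp 1 * (1 + (D : ℝ) / n)) ^ n := by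
  have hn' : (0 : ℝ) < n := by exact_mod_cast hn
  have hD' : (0 : ℝ) < D := by exact_mod_cast hD
  set t : ℝ := D / (n + D) with ht
  have ht0 : 0 < t := by positivity
  have ht1 : t < 1 := by rw [ht, div_lt_one (by positivity)]; linarith
  have h1 : ((degSet n D).card : ℝ) * t ^ D ≤ (1 + (D : ℝ) / n) ^ n := by
    calc ((degSet n D).card : ℝ) * t ^ D = ∑ k ∈ degSet n D, t ^ D := by simp
      _ ≤ ∑ k ∈ degSet n D, ∏ i, t ^ k i := by
          refine Finset.sum_le_sum fun k hk => ?_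
          rw [Finset.prod_pow_eq_pow_sum]
          exact pow_le_pow_of_le_one ht0.le ht1.le (Finset.mem_filter.1 hk).2
      _ ≤ ∑ k ∈ Fintype.piFinset fun _ : Fin n => Finset.range (D + 1), ∏ i, t ^ k i :=
          Finset.sum_le_sum_of_subset_of_nonneg (Finset.filter_subset _ _)
            fun k _ _ => Finset.prod_nonneg fun i _ => by positivity
      _ = ∏ _i : Fin n, ∑ j ∈ Finset.range (D + 1), t ^ j :=
          (Finset.prod_univ_sum (fun _ : Fin n => Finset.range (D + 1)) (fun _ j => t ^ j)).symm
      _ = (∑ j ∈ Finset.range (D + 1), t ^ j) ^ n := by simp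
      _ ≤ _ := by
          apply pow_le_pow_left₀ (Finset.sum_nonneg fun i _ => by positivity)
          have h2 : 1 + (D : ℝ) / n = (1 - t)⁻¹ := by
            have h3 : 1 - t = n / (n + D) := by rw [ht]; field_simp; ring
            rw [h3, inv_div, add_div, div_self hn'.ne']
          rw [h2, ← tsum_geometric_of_lt_one ht0.le ht1]
          exact Summable.sum_le_tsum _ (fun i _ => by positivity)
            (summable_geometric_of_lt_one ht0.le ht1)
  have h3 : (t⁻¹) ^ D ≤ Real.exp 1 ^ n := by
    have h4 : t⁻¹ = 1 + (n : ℝ) / D := by rw [ht]; field_simp; ring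
    have h5 : t⁻¹ ≤ Real.exp (n / D) := by
      rw [h4]; linarith [Real.add_one_le_exp ((n : ℝ) / D)]
    calc (t⁻¹) ^ D ≤ Real.exp (n / D) ^ D := pow_le_pow_left₀ (by positivity) h5 _
      _ = Real.exp 1 ^ n := by
        rw [← Real.exp_nat_mul, ← Real.exp_nat_mul]; congr 1; field_simp
  calc ((degSet n D).card : ℝ) = (t⁻¹) ^ D * (((degSet n D).card : ℝ) * t ^ D) := by
        rw [inv_pow]; field_simp
    _ ≤ Real.exp 1 ^ n * (1 + (D : ℝ) / n) ^ n :=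
        mul_le_mul h3 h1 (by positivity) (by positivity)
    _ = _ := by rw [mul_pow]

lemma numeric (n d M : ℕ) (hn : 1 ≤ n) (hd : 2 ≤ d) (hM : 18 * ((n : ℝ) * Real.log d) ≤ M) :
    ((degSet n (d * M)).card : ℝ) < (3 / 2) ^ M := by
  have hn' : (0 : ℝ) < n := by exact_mod_cast hn
  have hd' : (2 : ℝ) ≤ d := by exact_mod_cast hd
  have hlog2 := Real.log_two_gt_d9
  have hlogd : Real.log 2 ≤ Real.log d := Real.log_le_log (by norm_num) hd'
  set y : ℝ := M / n with hy
  have hMy : (M : ℝ) = n * y := by rw [hy]; field_simp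
  have hy18 : 18 * Real.log d ≤ y := by
    rw [hy, le_div_iff₀ hn']; linarith
  have hy12 : 12 < y := by linarith
  have hMpos : (0 : ℝ) < M := by rw [hMy]; positivity
  have hM1 : 1 ≤ M := by exact_mod_cast hMpos
  have h32 : (2 / 5 : ℝ) ≤ Real.log (3 / 2) := by
    have h1 : Real.exp 2 ≤ (3 / 2 : ℝ) ^ 5 := by
      have : Real.exp 2 = Real.exp 1 ^ 2 := by rw [← Real.exp_nat_mul]; norm_num
      rw [this]
      have := Real.exp_one_lt_d9
      have h0 := Real.exp_pos 1
      nlinarith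
    have h2 := Real.log_le_log (Real.exp_pos 2) h1
    rw [Real.log_exp, Real.log_pow] at h2
    push_cast at h2; linarith
  have hmain : Real.exp 1 * (1 + d * y) < Real.exp (2 / 5 * y) := by
    have h1 : 1 + d * y ≤ d * (1 / 2 + y) := by nlinarith
    have h2 : (d : ℝ) ≤ Real.exp (y / 18) := by
      rw [← Real.log_le_iff_le_exp (by linarith)]; linarith
    have h3 : 1 / 2 + y ≤ Real.exp ((1 / 2 + y) / 16 + 4 * Real.log 2 - 1) := by
      have h4 := Real.add_one_le_exp ((1 / 2 + y) / 16 - 1)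
      have h5 : Real.exp (4 * Real.log 2) = 16 := by
        rw [show (4 : ℝ) * Real.log 2 = ((4 : ℕ) : ℝ) * Real.log 2 by norm_num, Real.exp_nat_mul,
          Real.exp_log (by norm_num)]; norm_num
      rw [show (1 / 2 + y) / 16 + 4 * Real.log 2 - 1 = ((1 / 2 + y) / 16 - 1) + 4 * Real.log 2 by ring,
        Real.exp_add, h5]
      linarith
    calc Real.exp 1 * (1 + d * y)
        ≤ Real.exp 1 * (Real.exp (y / 18) * Real.exp ((1 / 2 + y) / 16 + 4 * Real.log 2 - 1)) := by
          apply mul_le_mul_of_nonneg_left _ (Real.exp_pos 1).le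
          exact h1.trans (mul_le_mul h2 h3 (by linarith) (Real.exp_pos _).le)
      _ = Real.exp (1 + (y / 18 + ((1 / 2 + y) / 16 + 4 * Real.log 2 - 1))) := by
          rw [← Real.exp_add, ← Real.exp_add]
      _ < _ := by
          apply Real.exp_lt_exp.2
          have := Real.log_two_lt_d9
          linarith
  have h1 := card_degSet_le n (d * M) hn (by nlinarith)
  have h2 : (((d * M : ℕ) : ℝ)) / n = d * y := by push_cast; rw [hy]; ring
  rw [h2] at h1
  refine h1.trans_lt ?_
  calc (Real.exp 1 * (1 + d * y)) ^ n < Real.exp (2 / 5 * y) ^ n :=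
        pow_lt_pow_left₀ hmain (by positivity) (by omega)
    _ = Real.exp (2 / 5 * M) := by rw [← Real.exp_nat_mul, hMy]; congr 1; ring
    _ ≤ Real.exp (M * Real.log (3 / 2)) := Real.exp_le_exp.2 (by nlinarith)
    _ = _ := by rw [Real.exp_nat_mul, Real.exp_log (by norm_num)]

/-! ### One dimensional bump -/

/-- truncated power -/
def tp (k : ℕ) (t : ℝ) : ℝ := (max t 0) ^ k

lemma tp_continuous (k : ℕ) : Continuous (tp k) := by unfold tp; fun_prop

lemma tp_hasDerivAt (k : ℕ) (t : ℝ) : HasDerivAt (tp (k + 2)) ((k + 2) * tp (k + 1) t) t := by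
  have hne : ∀ y : ℝ, y ≠ 0 → HasDerivAt (tp (k + 2)) ((k + 2) * tp (k + 1) y) y := by
    intro y hy
    rcases lt_or_gt_of_ne hy with h | h
    · have h1 : tp (k + 2) =ᶠ[nhds y] fun _ => (0 : ℝ) := by
        filter_upwards [Iio_mem_nhds h] with z hz
        simp [tp, max_eq_right (le_of_lt (mem_Iio.1 hz))]
      have h2 : ((k : ℝ) + 2) * tp (k + 1) y = 0 := by simp [tp, max_eq_right h.le]
      rw [h2]
      exact (hasDerivAt_const y (0 : ℝ)).congr_of_eventuallyEq h1
    · have h1 : tp (k + 2) =ᶠ[nhds y] fun z => z ^ (k + 2) := by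
        filter_upwards [Ioi_mem_nhds h] with z hz
        simp [tp, max_eq_left (le_of_lt (mem_Ioi.1 hz))]
      have h2 : ((k : ℝ) + 2) * tp (k + 1) y = ((k + 2 : ℕ) : ℝ) * y ^ (k + 2 - 1) := by
        simp [tp, max_eq_left h.le]
      rw [h2]
      exact (hasDerivAt_pow (k + 2) y).congr_of_eventuallyEq h1
  by_cases ht : t = 0
  · subst ht
    exact hasDerivAt_of_hasDerivAt_of_ne (fun y hy => hne y hy) (tp_continuous _).continuousAt
      (continuous_const.mul (tp_continuous _)).continuousAt
  · exact hne t ht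

lemma tp_contDiff (k : ℕ) : ContDiff ℝ k (tp (k + 1)) := by
  induction k with
  | zero => exact contDiff_zero.2 (tp_continuous _)
  | succ k ih =>
    have hd : deriv (tp (k + 1 + 1)) = fun t => ((k : ℝ) + 2) * tp (k + 1) t :=
      funext fun t => (tp_hasDerivAt k t).deriv
    rw [show ((k + 1 : ℕ) : WithTop ℕ∞) = (k : WithTop ℕ∞) + 1 by push_cast; rfl, contDiff_succ_iff_deriv]
    refine ⟨fun t => (tp_hasDerivAt k t).differentiableAt, by simp, ?_⟩
    rw [hd]
    exact contDiff_const.mul ih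

lemma tp_iteratedDeriv (k j : ℕ) (hj : j < k) :
    iteratedDeriv j (tp k) = fun t => (k.descFactorial j : ℝ) * tp (k - j) t := by
  induction j with
  | zero => simp
  | succ j ih =>
    rw [iteratedDeriv_succ, ih (by omega)]
    funext t
    obtain ⟨r, hr⟩ : ∃ r, k - j = r + 2 := ⟨k - j - 2, by omega⟩
    rw [hr, ((tp_hasDerivAt r t).const_mul _).deriv, Nat.descFactorial_succ, hr,
      show k - (j + 1) = r + 1 by omega]
    push_cast; ring

/-- the bump -/
def bump (p : ℕ) (t : ℝ) : ℝ := tp p t * tp p (1 - t)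

lemma bump_contDiff (p : ℕ) : ContDiff ℝ p (bump (p + 1)) := by
  unfold bump
  exact (tp_contDiff p).mul ((tp_contDiff p).comp (contDiff_const.sub contDiff_id))

/-- the pointwise size of the bump and its derivatives -/
def bsize (p : ℕ) (t : ℝ) : ℝ := if t ∈ Ioo (0 : ℝ) 1 then ((4 : ℝ) ^ p)⁻¹ else 0

lemma bsize_nonneg (p : ℕ) (t : ℝ) : 0 ≤ bsize p t := by unfold bsize; split_ifs <;> positivity

lemma bump_deriv_bound (p j : ℕ) (hj : j ≤ p) (t : ℝ) :
    ‖iteratedFDeriv ℝ j (bump (p + 1)) t‖ ≤ bsize (p + 1) t * (4 * ((p : ℝ) + 1)) ^ j := by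
  set P := p + 1 with hP
  have hmul := norm_iteratedFDeriv_mul_le (𝕜 := ℝ) (N := (p : WithTop ℕ∞)) (f := tp P)
    (g := fun t => tp P (1 - t)) (tp_contDiff p)
    ((tp_contDiff p).comp (contDiff_const.sub contDiff_id)) t (n := j) (by exact_mod_cast hj)
  have hstep : ∀ i ∈ Finset.range (j + 1),
      (j.choose i : ℝ) * ‖iteratedFDeriv ℝ i (tp P) t‖ * ‖iteratedFDeriv ℝ (j - i) (fun t => tp P (1 - t)) t‖
      ≤ (P : ℝ) ^ j * ((tp 1 t * tp 1 (1 - t)) ^ (P - j)) *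
        ((tp 1 (1 - t)) ^ i * (tp 1 t) ^ (j - i) * j.choose i) := by
    intro i hi
    have hi' : i ≤ j := by simpa [Nat.lt_succ_iff] using hi
    rw [norm_iteratedFDeriv_eq_norm_iteratedDeriv, norm_iteratedFDeriv_eq_norm_iteratedDeriv,
      iteratedDeriv_comp_const_sub, tp_iteratedDeriv _ _ (by omega), tp_iteratedDeriv _ _ (by omega)]
    have n1 : ‖(P.descFactorial i : ℝ) * tp (P - i) t‖ ≤ (P : ℝ) ^ i * tp 1 t ^ (P - i) := by
      rw [Real.norm_of_nonneg (by unfold tp; positivity)]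
      have : tp (P - i) t = tp 1 t ^ (P - i) := by simp [tp]
      rw [this]
      apply mul_le_mul_of_nonneg_right _ (by unfold tp; positivity)
      exact_mod_cast Nat.descFactorial_le_pow _ _
    have n2 : ‖(-1 : ℝ) ^ (j - i) • ((P.descFactorial (j - i) : ℝ) * tp (P - (j - i)) (1 - t))‖
        ≤ (P : ℝ) ^ (j - i) * tp 1 (1 - t) ^ (P - (j - i)) := by
      rw [norm_smul, norm_pow, norm_neg, norm_one, one_pow, one_mul,
        Real.norm_of_nonneg (by unfold tp; positivity)]
      have : tp (P - (j - i)) (1 - t) = tp 1 (1 - t) ^ (P - (j - i)) := by simp [tp]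
      rw [this]
      apply mul_le_mul_of_nonneg_right _ (by unfold tp; positivity)
      exact_mod_cast Nat.descFactorial_le_pow _ _
    have e1 : P - i = (P - j) + (j - i) := by omega
    have e2 : P - (j - i) = (P - j) + i := by omega
    have e3 : (P : ℝ) ^ j = (P : ℝ) ^ i * (P : ℝ) ^ (j - i) := by rw [← pow_add]; congr 1; omega
    calc _ ≤ (j.choose i : ℝ) * ((P : ℝ) ^ i * tp 1 t ^ (P - i)) *
          ((P : ℝ) ^ (j - i) * tp 1 (1 - t) ^ (P - (j - i))) := by
          apply mul_le_mul (mul_le_mul_of_nonneg_left n1 (by positivity)) n2 (norm_nonneg _)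
          unfold tp; positivity
      _ = _ := by rw [e1, e2, e3, mul_pow, pow_add, pow_add]; ring
  have hsum := hmul.trans (Finset.sum_le_sum hstep)
  rw [← Finset.mul_sum, ← add_pow] at hsum
  change ‖iteratedFDeriv ℝ j (bump P) t‖ ≤ _ at hsum
  refine hsum.trans ?_
  unfold bsize
  split_ifs with ht
  · have t1 : tp 1 t = t := by simp [tp, ht.1.le]
    have t2 : tp 1 (1 - t) = 1 - t := by simp [tp, ht.2.le]
    rw [t1, t2]
    have h1 : (t * (1 - t)) ^ (P - j) ≤ (1 / 4) ^ (P - j) := by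
      apply pow_le_pow_left₀ (mul_nonneg ht.1.le (by linarith [ht.2]))
      nlinarith [sq_nonneg (t - 1 / 2)]
    have h2 : ((4 : ℝ) ^ P)⁻¹ * (4 * ((p : ℝ) + 1)) ^ j = (P : ℝ) ^ j * (1 / 4) ^ (P - j) := by
      have : (4 : ℝ) ^ P = 4 ^ (P - j) * 4 ^ j := by rw [← pow_add]; congr 1; omega
      rw [this, mul_pow, hP]; push_cast
      field_simp
      rw [← mul_pow]; norm_num
    rw [h2, show 1 - t + t = 1 by ring, one_pow, mul_one]
    exact mul_le_mul_of_nonneg_left h1 (by positivity)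
  · have : tp 1 t * tp 1 (1 - t) = 0 := by
      simp only [tp, pow_one]
      by_cases h : t ≤ 0
      · simp [max_eq_right h]
      · have : 1 ≤ t := by
          by_contra h'; exact ht ⟨by linarith, by linarith⟩
        rw [max_eq_right (by linarith : 1 - t ≤ 0), mul_zero]
    rw [this, zero_pow (by omega)]
    simp

lemma integral_bump (p : ℕ) :
    ∫ t, bump (p + 1) t = ((Nat.factorial (p + 1) : ℝ)) ^ 2 / (Nat.factorial (2 * (p + 1) + 1) : ℝ) := by
  have h1 : ∫ t, bump (p + 1) t = ∫ t in (0 : ℝ)..1, t ^ (p + 1) * (1 - t) ^ (p + 1) := by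
    rw [intervalIntegral.integral_of_le (by norm_num)]
    have h0 : ∫ t, bump (p + 1) t = ∫ t in Ioc (0 : ℝ) 1, bump (p + 1) t := by
      symm
      apply setIntegral_eq_integral_of_forall_compl_eq_zero
      intro t ht
      by_cases h : t ≤ 0
      · simp [bump, tp, max_eq_right h]
      · have : 1 < t := by
          by_contra h'; exact ht ⟨by linarith, by linarith⟩
        simp [bump, tp, max_eq_right (by linarith : 1 - t ≤ 0)]
    rw [h0]
    apply setIntegral_congr_fun measurableSet_Ioc
    intro t ht
    simp [bump, tp, ht.1.le, ht.2]
  rw [h1]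
  have h2 : ∀ b a : ℕ, ∫ t in (0 : ℝ)..1, t ^ a * (1 - t) ^ b
      = (Nat.factorial a : ℝ) * (Nat.factorial b) / (Nat.factorial (a + b + 1)) := by
    intro b
    induction b with
    | zero =>
      intro a
      simp only [pow_zero, mul_one, integral_pow, add_zero, Nat.factorial_succ a, Nat.factorial_zero]
      have := Nat.factorial_pos a
      push_cast
      field_simp
      simp
    | succ b ih =>
      intro a
      have hip := intervalIntegral.integral_mul_deriv_eq_deriv_mul (a := 0) (b := 1)
        (u := fun t : ℝ => (1 - t) ^ (b + 1)) (v := fun t : ℝ => t ^ (a + 1) / (a + 1))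
        (u' := fun t => -(((b : ℝ) + 1) * (1 - t) ^ b)) (v' := fun t => t ^ a)
        (by
          intro t _
          have := ((hasDerivAt_id t).const_sub 1).pow (b + 1)
          have h9 : -(((b : ℝ) + 1) * (1 - t) ^ b) = ((b + 1 : ℕ) : ℝ) * (1 - id t) ^ (b + 1 - 1) * -1 := by
            simp
          rw [h9]
          exact this)
        (by
          intro t _
          have := (hasDerivAt_pow (a + 1) t).div_const ((a : ℝ) + 1)
          convert this using 1
          push_cast; field_simp; try simp)
        (Continuous.intervalIntegrable (by fun_prop) _ _)
        (Continuous.intervalIntegrable (by fun_prop) _ _)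
      have e1 : ∫ t in (0 : ℝ)..1, t ^ a * (1 - t) ^ (b + 1) = ∫ t in (0 : ℝ)..1, (1 - t) ^ (b + 1) * t ^ a := by
        congr 1; funext t; ring
      have e2 : ∫ t in (0 : ℝ)..1, -(((b : ℝ) + 1) * (1 - t) ^ b) * (t ^ (a + 1) / (a + 1))
          = -(((b : ℝ) + 1) / (a + 1)) * ∫ t in (0 : ℝ)..1, t ^ (a + 1) * (1 - t) ^ b := by
        rw [← intervalIntegral.integral_const_mul]
        congr 1; funext t; ring
      rw [e1, hip, e2, ih (a + 1), show a + 1 + b + 1 = a + (b + 1) + 1 by ring,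
        Nat.factorial_succ a, Nat.factorial_succ b]
      have := Nat.factorial_pos (a + (b + 1) + 1)
      push_cast
      field_simp
      simp
  rw [h2, show p + 1 + (p + 1) + 1 = 2 * (p + 1) + 1 by ring, sq]

/-! ### Multi-dimensional bumps -/

lemma prod_bound {E ι : Type*} [NormedAddCommGroup E] [NormedSpace ℝ E] [DecidableEq ι]
    (f : ι → E → ℝ) (K : ℕ) (hf : ∀ i, ContDiff ℝ K (f i)) (x : E) (C : ι → ℝ)
    (hC : ∀ i, 0 ≤ C i) (R : ℝ) (hR : 0 ≤ R)
    (h : ∀ i, ∀ j ≤ K, ‖iteratedFDeriv ℝ j (f i) x‖ ≤ C i * R ^ j) (u : Finset ι) :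
    ∀ j ≤ K, ‖iteratedFDeriv ℝ j (fun y => ∏ i ∈ u, f i y) x‖ ≤ (∏ i ∈ u, C i) * (u.card * R) ^ j := by
  induction u using Finset.induction_on with
  | empty =>
    intro j _
    rcases Nat.eq_zero_or_pos j with rfl | hj
    · simp
    · simp only [Finset.prod_empty]
      rw [iteratedFDeriv_const_of_ne (by omega)]
      simp
  | insert a u ha ih =>
    intro j hj
    have e : (fun y => ∏ i ∈ insert a u, f i y) = fun y => f a y * ∏ i ∈ u, f i y := by
      funext y; rw [Finset.prod_insert ha]
    rw [e, Finset.prod_insert ha, Finset.card_insert_of_notMem ha]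
    have hm := norm_iteratedFDeriv_mul_le (𝕜 := ℝ) (N := (K : WithTop ℕ∞)) (hf a)
      (contDiff_prod (t := u) fun i _ => hf i) x (n := j) (by exact_mod_cast hj)
    refine hm.trans ?_
    have hP : 0 ≤ ∏ i ∈ u, C i := Finset.prod_nonneg fun i _ => hC i
    calc _ ≤ ∑ i ∈ Finset.range (j + 1), (j.choose i : ℝ) * (C a * R ^ i) *
          ((∏ i ∈ u, C i) * (u.card * R) ^ (j - i)) := by
          refine Finset.sum_le_sum fun i hi => ?_
          have hi' : i ≤ j := by simpa [Nat.lt_succ_iff] using hi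
          have hCa := hC a
          apply mul_le_mul (mul_le_mul_of_nonneg_left (h a i (by omega)) (by positivity))
            (ih (j - i) (by omega)) (norm_nonneg _)
          positivity
      _ = C a * (∏ i ∈ u, C i) * (R + u.card * R) ^ j := by
          rw [add_pow, Finset.mul_sum]
          refine Finset.sum_congr rfl fun i _ => ?_
          ring
      _ = _ := by push_cast; congr 2; ring

lemma bump_zero (p : ℕ) (t : ℝ) (ht : t ∉ Ioo (0 : ℝ) 1) : bump (p + 1) t = 0 := by
  by_cases h : t ≤ 0
  · simp [bump, tp, max_eq_right h]
  · have : 1 ≤ t := by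
      by_contra h'; exact ht ⟨by linarith, by linarith⟩
    simp [bump, tp, max_eq_right (by linarith : 1 - t ≤ 0)]

/-- bump of a cell -/
def phi (s N p : ℕ) (q : Fin s → Fin N) (x : EuclideanSpace ℝ (Fin s)) : ℝ :=
  ∏ i, bump p (N * x i - ((q i : ℕ) : ℝ))

lemma factor_contDiff (s N p : ℕ) (i : Fin s) (r : ℝ) :
    ContDiff ℝ p (fun x : EuclideanSpace ℝ (Fin s) => bump (p + 1) (N * x i - r)) := by
  apply (bump_contDiff p).comp
  fun_prop

lemma factor_bound (s N p : ℕ) (i : Fin s) (r : ℝ) (x : EuclideanSpace ℝ (Fin s)) (j : ℕ) (hj : j ≤ p) :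
    ‖iteratedFDeriv ℝ j (fun x : EuclideanSpace ℝ (Fin s) => bump (p + 1) (N * x i - r)) x‖
      ≤ bsize (p + 1) (N * x i - r) * (4 * ((p : ℝ) + 1) * N) ^ j := by
  let L : EuclideanSpace ℝ (Fin s) →L[ℝ] ℝ := (N : ℝ) • (EuclideanSpace.proj i : EuclideanSpace ℝ (Fin s) →L[ℝ] ℝ)
  have hL : ‖L‖ ≤ N := by
    refine L.opNorm_le_bound (by positivity) fun y => ?_
    have : ‖y i‖ ≤ ‖y‖ := PiLp.norm_apply_le y i
    have e : L y = (N : ℝ) * y i := by simp [L]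
    rw [e, norm_mul, Real.norm_natCast]
    exact mul_le_mul_of_nonneg_left this (by positivity)
  have hg : ContDiff ℝ p (fun t => bump (p + 1) (t - r)) := (bump_contDiff p).comp (by fun_prop)
  have e : (fun x : EuclideanSpace ℝ (Fin s) => bump (p + 1) (N * x i - r))
      = (fun t => bump (p + 1) (t - r)) ∘ L := by
    funext y; simp [L]
  rw [e, ContinuousLinearMap.iteratedFDeriv_comp_right L hg x (i := j) (by exact_mod_cast hj)]
  refine (ContinuousMultilinearMap.norm_compContinuousLinearMap_le _ _).trans ?_
  rw [iteratedFDeriv_comp_sub, Finset.prod_const, Finset.card_univ, Fintype.card_fin, mul_pow, ← mul_assoc]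
  have hb := bump_deriv_bound p j hj (L x - r)
  have hLx : L x - r = N * x i - r := by simp [L]
  rw [hLx] at hb ⊢
  have hB := bsize_nonneg (p + 1) (N * x i - r)
  exact mul_le_mul hb (pow_le_pow_left₀ (norm_nonneg _) hL _) (by positivity) (by positivity)

lemma phi_contDiff (s N p : ℕ) (q : Fin s → Fin N) : ContDiff ℝ p (phi s N (p + 1) q) := by
  unfold phi
  exact contDiff_prod fun i _ => factor_contDiff s N p i _

lemma phi_bound (s N p : ℕ) (q : Fin s → Fin N) (x : EuclideanSpace ℝ (Fin s)) (j : ℕ) (hj : j ≤ p) :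
    ‖iteratedFDeriv ℝ j (phi s N (p + 1) q) x‖
      ≤ (∏ i, bsize (p + 1) (N * x i - ((q i : ℕ) : ℝ))) * (s * (4 * ((p : ℝ) + 1) * N)) ^ j := by
  have := prod_bound (fun (i : Fin s) (x : EuclideanSpace ℝ (Fin s)) =>
      bump (p + 1) (N * x i - ((q i : ℕ) : ℝ))) p
    (fun i => factor_contDiff s N p i _) x (fun i => bsize (p + 1) (N * x i - ((q i : ℕ) : ℝ)))
    (fun i => bsize_nonneg _ _) (4 * ((p : ℝ) + 1) * N) (by positivity)
    (fun i j hj => factor_bound s N p i _ x j hj) Finset.univ j hj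
  rw [Finset.card_univ, Fintype.card_fin] at this
  exact this

lemma cell_unique (N : ℕ) (t : ℝ) (a b : Fin N) (ha : t - ((a : ℕ) : ℝ) ∈ Ico (0 : ℝ) 1)
    (hb : t - ((b : ℕ) : ℝ) ∈ Ico (0 : ℝ) 1) : a = b := by
  have h1 : ((a : ℕ) : ℝ) < ((b : ℕ) : ℝ) + 1 := by linarith [ha.1, hb.2]
  have h2 : ((b : ℕ) : ℝ) < ((a : ℕ) : ℝ) + 1 := by linarith [hb.1, ha.2]
  have h1' : (a : ℕ) < (b : ℕ) + 1 := by exact_mod_cast h1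
  have h2' : (b : ℕ) < (a : ℕ) + 1 := by exact_mod_cast h2
  exact Fin.ext (by omega)

/-- Signed sum of bumps. -/
def hsum (s N p : ℕ) (ε : (Fin s → Fin N) → Bool) (x : EuclideanSpace ℝ (Fin s)) : ℝ :=
  ∑ q, sgn (ε q) * phi s N p q x

lemma hsum_contDiff (s N p : ℕ) (ε : (Fin s → Fin N) → Bool) : ContDiff ℝ p (hsum s N (p + 1) ε) := by
  unfold hsum
  exact ContDiff.sum fun q _ => contDiff_const.mul (phi_contDiff s N p q)

lemma sgn_abs (b : Bool) : ‖sgn b‖ = 1 := by cases b <;> simp [sgn]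

lemma sum_bsize (s N p : ℕ) (x : EuclideanSpace ℝ (Fin s)) :
    ∑ q : Fin s → Fin N, ∏ i, bsize p (N * x i - ((q i : ℕ) : ℝ)) ≤ (((4 : ℝ) ^ p)⁻¹) ^ s := by
  have h0 : ∀ t : ℝ, ∑ a : Fin N, bsize p (t - ((a : ℕ) : ℝ)) ≤ ((4 : ℝ) ^ p)⁻¹ := by
    intro t
    by_cases h : ∃ a : Fin N, t - ((a : ℕ) : ℝ) ∈ Ioo (0 : ℝ) 1
    · obtain ⟨a, ha⟩ := h
      rw [Finset.sum_eq_single a]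
      · simp [bsize, ha]
      · intro b _ hb
        have : ¬ (t - ((b : ℕ) : ℝ) ∈ Ioo (0 : ℝ) 1) := fun hb' =>
          hb (cell_unique N t b a (Ioo_subset_Ico_self hb') (Ioo_subset_Ico_self ha))
        simp only [bsize, if_neg this]
      · simp
    · push Not at h
      rw [Finset.sum_eq_zero]
      · positivity
      · intro a _
        simp only [bsize, if_neg (h a)]
  have := Finset.prod_univ_sum (fun _ : Fin s => (Finset.univ : Finset (Fin N)))
    (fun i a => bsize p (N * x i - ((a : ℕ) : ℝ)))
  rw [Fintype.piFinset_univ] at this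
  rw [← this]
  calc _ ≤ ∏ _i : Fin s, ((4 : ℝ) ^ p)⁻¹ := Finset.prod_le_prod
        (fun i _ => Finset.sum_nonneg fun a _ => bsize_nonneg _ _) fun i _ => h0 _
    _ = _ := by simp

lemma hsum_bound (s N p : ℕ) (ε : (Fin s → Fin N) → Bool) (x : EuclideanSpace ℝ (Fin s)) (j : ℕ)
    (hj : j ≤ p) :
    ‖iteratedFDeriv ℝ j (hsum s N (p + 1) ε) x‖
      ≤ (((4 : ℝ) ^ (p + 1))⁻¹) ^ s * (s * (4 * ((p : ℝ) + 1) * N)) ^ j := by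
  have hcd : ∀ q, ContDiff ℝ j (phi s N (p + 1) q) := fun q =>
    (phi_contDiff s N p q).of_le (by exact_mod_cast hj)
  have e : hsum s N (p + 1) ε = ∑ q, sgn (ε q) • phi s N (p + 1) q := by
    funext x; simp [hsum]
  have hcs : ∀ q ∈ (Finset.univ : Finset (Fin s → Fin N)),
      ContDiffAt ℝ j (sgn (ε q) • phi s N (p + 1) q) x := fun q _ =>
    (ContDiff.const_smul (sgn (ε q)) (hcd q)).contDiffAt
  rw [e, iteratedFDeriv_sum_apply hcs]
  refine (norm_sum_le _ _).trans ?_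
  calc _ ≤ ∑ q : Fin s → Fin N, (∏ i, bsize (p + 1) (N * x i - ((q i : ℕ) : ℝ))) *
          (s * (4 * ((p : ℝ) + 1) * N)) ^ j := by
        refine Finset.sum_le_sum fun q _ => ?_
        rw [iteratedFDeriv_const_smul_apply (hcd q).contDiffAt, norm_smul, sgn_abs, one_mul]
        exact phi_bound s N p q x j hj
    _ ≤ _ := by
        rw [← Finset.sum_mul]
        exact mul_le_mul_of_nonneg_right (sum_bsize s N (p + 1) x) (by positivity)

lemma cube_uniqueDiffOn (s : ℕ) : UniqueDiffOn ℝ (cube s) := by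
  apply uniqueDiffOn_convex
  · intro x hx y hy a b ha hb hab i
    have := (convex_Icc (0 : ℝ) 1) (hx i) (hy i) ha hb hab
    simpa using this
  · refine ⟨WithLp.toLp 2 fun _ => (1 / 2 : ℝ), ?_⟩
    rw [mem_interior]
    refine ⟨{x | ∀ i, x i ∈ Ioo (0 : ℝ) 1}, fun x hx i => Ioo_subset_Icc_self (hx i), ?_, ?_⟩
    · have : {x : EuclideanSpace ℝ (Fin s) | ∀ i, x i ∈ Ioo (0 : ℝ) 1}
          = ⋂ i, (fun x : EuclideanSpace ℝ (Fin s) => x i) ⁻¹' Ioo (0 : ℝ) 1 := by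
        ext x; simp
      rw [this]
      exact isOpen_iInter_of_finite fun i => isOpen_Ioo.preimage (by fun_prop)
    · intro i; simp; norm_num

lemma hsum_holder (s N m : ℕ) (hs : 1 ≤ s) (hN : 1 ≤ N) (α : ℝ) (hα0 : 0 < α) (hα1 : α ≤ 1)
    (ε : (Fin s → Fin N) → Bool) (a : ℝ)
    (ha : a = (N : ℝ) ^ (-((m : ℝ) + α)) * ((4 : ℝ) ^ (m + 2)) ^ s /
      (2 * (s * (4 * ((m : ℝ) + 2))) ^ (m + 1))) :
    HolderClass s m α (fun x => a * hsum s N (m + 2) ε x) := by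
  have hN' : (1 : ℝ) ≤ N := by exact_mod_cast hN
  have hs' : (1 : ℝ) ≤ s := by exact_mod_cast hs
  have hN0 : (0 : ℝ) < N := by linarith
  have ha0 : 0 < a := by rw [ha]; positivity
  set h : EuclideanSpace ℝ (Fin s) → ℝ := fun x => a * hsum s N (m + 2) ε x with hh
  have hcd : ContDiff ℝ ((m + 1 : ℕ)) h := contDiff_const.mul (hsum_contDiff s N (m + 1) ε)
  have hcdm : ContDiff ℝ m h := hcd.of_le (by exact_mod_cast Nat.le_succ m)
  set B : ℝ := s * (4 * ((m : ℝ) + 2)) with hB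
  have hB1 : 1 ≤ B := by rw [hB]; nlinarith
  have hbd : ∀ j ≤ m + 1, ∀ x, ‖iteratedFDeriv ℝ j h x‖ ≤ (N : ℝ) ^ (-((m : ℝ) + α)) * N ^ j / 2 := by
    intro j hj x
    have e : h = a • hsum s N (m + 2) ε := by funext y; simp [hh]
    rw [e, iteratedFDeriv_const_smul_apply
      ((hsum_contDiff s N (m + 1) ε).of_le (by exact_mod_cast hj)).contDiffAt, norm_smul,
      Real.norm_of_nonneg ha0.le]
    have h1 := hsum_bound s N (m + 1) ε x j hj
    have h2 : ((s : ℝ) * (4 * (((m + 1 : ℕ) : ℝ) + 1) * N)) = B * N := by rw [hB]; push_cast; ring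
    rw [h2, mul_pow] at h1
    have h3 : B ^ j ≤ B ^ (m + 1) := pow_le_pow_right₀ hB1 hj
    calc _ ≤ a * ((((4 : ℝ) ^ (m + 1 + 1))⁻¹) ^ s * (B ^ (m + 1) * N ^ j)) := by
          refine mul_le_mul_of_nonneg_left (h1.trans ?_) ha0.le
          gcongr
      _ = _ := by rw [ha, inv_pow, show m + 1 + 1 = m + 2 by ring]; field_simp
  have hnorm : ∀ j : ℕ, (N : ℝ) ^ (-((m : ℝ) + α)) * N ^ j = (N : ℝ) ^ ((j : ℝ) - m - α) := by
    intro j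
    rw [← Real.rpow_natCast, ← Real.rpow_add hN0]; congr 1; ring
  have hwithin : ∀ j ≤ m, ∀ x ∈ cube s, iteratedFDerivWithin ℝ j h (cube s) x = iteratedFDeriv ℝ j h x := by
    intro j hj x hx
    exact iteratedFDerivWithin_eq_iteratedFDeriv (cube_uniqueDiffOn s)
      ((hcdm.of_le (by exact_mod_cast hj)).contDiffAt) hx
  refine ⟨hcdm.contDiffOn, ?_, ?_⟩
  · intro j hj x hx
    rw [hwithin j hj x hx]
    refine (hbd j (by omega) x).trans ?_
    rw [hnorm]
    have hjm : (j : ℝ) ≤ m := by exact_mod_cast hj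
    have := Real.rpow_le_one_of_one_le_of_nonpos hN' (by linarith : (j : ℝ) - m - α ≤ 0)
    linarith
  · intro x hx y hy
    rw [hwithin m le_rfl x hx, hwithin m le_rfl y hy]
    set r := ‖x - y‖ with hr
    have hr0 : 0 ≤ r := norm_nonneg _
    have hNα : (N : ℝ) ^ (-α) * ((N : ℝ) * r) ^ α = r ^ α := by
      rw [Real.mul_rpow hN0.le hr0, ← mul_assoc, ← Real.rpow_add hN0]; simp
    have hpos : 0 < (N : ℝ) ^ (-α) := Real.rpow_pos_of_pos hN0 _
    rcases le_or_gt ((N : ℝ) * r) 1 with hc | hc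
    · have hlip : ‖iteratedFDeriv ℝ m h x - iteratedFDeriv ℝ m h y‖
          ≤ ((N : ℝ) ^ (-((m : ℝ) + α)) * N ^ (m + 1) / 2) * ‖x - y‖ := by
        apply Convex.norm_image_sub_le_of_norm_fderiv_le (𝕜 := ℝ) (s := univ)
          (f := iteratedFDeriv ℝ m h) (x := y) (y := x) _ _ convex_univ (mem_univ _) (mem_univ _)
        · intro z _
          exact (hcd.differentiable_iteratedFDeriv (by exact_mod_cast Nat.lt_succ_self m)) z
        · intro z _
          rw [norm_fderiv_iteratedFDeriv]
          exact hbd (m + 1) le_rfl z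
      refine hlip.trans ?_
      rw [hnorm, ← hr, ← hNα]
      have e1 : (N : ℝ) ^ ((((m + 1 : ℕ) : ℝ)) - m - α) = (N : ℝ) ^ (-α) * N := by
        rw [← Real.rpow_add_one hN0.ne']; congr 1; push_cast; ring
      rw [e1]
      have h5 : (N : ℝ) * r ≤ ((N : ℝ) * r) ^ α := by
        rcases hr0.eq_or_lt with h0 | h0
        · rw [← h0, mul_zero, Real.zero_rpow hα0.ne']
        · have := Real.rpow_le_rpow_of_exponent_ge (by positivity) hc hα1
          simpa using this
      have h6 := mul_le_mul_of_nonneg_left h5 hpos.le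
      have h7 : 0 ≤ (N : ℝ) ^ (-α) * (N * r) := by positivity
      linarith
    · have h1 := hbd m (by omega) x
      have h2 := hbd m (by omega) y
      rw [hnorm, show (m : ℝ) - m - α = -α by ring] at h1 h2
      have h3 := norm_sub_le (iteratedFDeriv ℝ m h x) (iteratedFDeriv ℝ m h y)
      rw [← hNα]
      have h5 : 1 ≤ ((N : ℝ) * r) ^ α := Real.one_le_rpow hc.le hα0.le
      nlinarith

/-! ### Integrals -/

/-- grid cell -/
def cell (s N : ℕ) (q : Fin s → Fin N) : Set (EuclideanSpace ℝ (Fin s)) :=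
  {x | ∀ i, (N : ℝ) * x i - ((q i : ℕ) : ℝ) ∈ Ico (0 : ℝ) 1}

lemma cell_measurable (s N : ℕ) (q : Fin s → Fin N) : MeasurableSet (cell s N q) := by
  have : cell s N q = ⋂ i, (fun x : EuclideanSpace ℝ (Fin s) => (N : ℝ) * x i - ((q i : ℕ) : ℝ)) ⁻¹' Ico (0 : ℝ) 1 := by
    ext x; simp [cell]
  rw [this]
  refine MeasurableSet.iInter fun i => measurableSet_Ico.preimage ?_
  apply Continuous.measurable
  fun_prop

lemma cube_isClosed (s : ℕ) : IsClosed (cube s) := by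
  have : cube s = ⋂ i, (fun x : EuclideanSpace ℝ (Fin s) => x i) ⁻¹' Icc (0 : ℝ) 1 := by
    ext x; simp [cube]
  rw [this]
  exact isClosed_iInter fun i => isClosed_Icc.preimage (by fun_prop)

lemma cube_isCompact (s : ℕ) : IsCompact (cube s) := by
  refine Metric.isCompact_of_isClosed_isBounded (cube_isClosed s) ?_
  refine isBounded_iff_forall_norm_le.2 ⟨Real.sqrt (∑ _i : Fin s, 1), fun x hx => ?_⟩
  rw [EuclideanSpace.norm_eq]
  apply Real.sqrt_le_sqrt
  refine Finset.sum_le_sum fun i _ => ?_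
  have := hx i
  rw [Real.norm_eq_abs, sq_abs]
  nlinarith [this.1, this.2]

lemma cell_subset (s N : ℕ) (hN : 1 ≤ N) (q : Fin s → Fin N) : cell s N q ⊆ cube s := by
  intro x hx i
  have h := hx i
  have hN' : (1 : ℝ) ≤ N := by exact_mod_cast hN
  have hq : ((q i : ℕ) : ℝ) + 1 ≤ N := by exact_mod_cast (q i).2
  have hq0 : (0 : ℝ) ≤ ((q i : ℕ) : ℝ) := by positivity
  constructor
  · by_contra hc
    push Not at hc
    nlinarith [h.1]
  · by_contra hc
    push Not at hc
    nlinarith [h.2]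

lemma cell_disjoint (s N : ℕ) : Pairwise (Function.onFun Disjoint (cell s N)) := by
  intro q q' hne
  rw [Function.onFun, Set.disjoint_left]
  intro x hx hx'
  exact hne (funext fun i => cell_unique N _ _ _ (hx i) (hx' i))

lemma phi_zero (s N p : ℕ) (q : Fin s → Fin N) (x : EuclideanSpace ℝ (Fin s)) (hx : x ∉ cell s N q) :
    phi s N (p + 1) q x = 0 := by
  simp only [cell, mem_setOf_eq, not_forall] at hx
  obtain ⟨i, hi⟩ := hx
  exact Finset.prod_eq_zero (Finset.mem_univ i)
    (bump_zero p _ fun h => hi (Ioo_subset_Ico_self h))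

lemma hsum_cell (s N p : ℕ) (ε : (Fin s → Fin N) → Bool) (q : Fin s → Fin N)
    (x : EuclideanSpace ℝ (Fin s)) (hx : x ∈ cell s N q) :
    hsum s N (p + 1) ε x = sgn (ε q) * phi s N (p + 1) q x := by
  unfold hsum
  rw [Finset.sum_eq_single q]
  · intro q' _ hne
    rw [phi_zero, mul_zero]
    exact fun hx' => Set.disjoint_left.1 (cell_disjoint s N hne) hx' hx
  · simp

lemma integral_phi (s N p : ℕ) (q : Fin s → Fin N) :
    ∫ x in cell s N q, phi s N (p + 1) q x = ((∫ t, bump (p + 1) t) / N) ^ s := by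
  rw [setIntegral_eq_integral_of_forall_compl_eq_zero fun x hx => phi_zero s N p q x hx]
  rw [← (PiLp.volume_preserving_toLp (Fin s)).integral_comp
    (MeasurableEquiv.toLp 2 (Fin s → ℝ)).measurableEmbedding]
  have e : ∀ y : Fin s → ℝ, phi s N (p + 1) q (WithLp.toLp 2 y)
      = ∏ i, (fun t : ℝ => bump (p + 1) (N * t - ((q i : ℕ) : ℝ))) (y i) := fun y => rfl
  simp_rw [e]
  rw [integral_fintype_prod_volume_eq_prod (fun i (t : ℝ) => bump (p + 1) (N * t - ((q i : ℕ) : ℝ)))]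
  have e2 : ∀ i, ∫ t : ℝ, bump (p + 1) (N * t - ((q i : ℕ) : ℝ)) = (∫ t, bump (p + 1) t) / N := by
    intro i
    rw [Measure.integral_comp_mul_left (fun t => bump (p + 1) (t - ((q i : ℕ) : ℝ))) (N : ℝ),
      integral_sub_right_eq_self (bump (p + 1))]
    rw [abs_of_nonneg (by positivity), smul_eq_mul]; ring
  rw [Finset.prod_congr rfl fun i _ => e2 i]
  rw [Finset.prod_const, Finset.card_univ, Fintype.card_fin]

lemma l1_cells (s N : ℕ) (hN : 1 ≤ N) (F : EuclideanSpace ℝ (Fin s) → ℝ) (hF : IntegrableOn F (cube s)) :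
    ∑ q, |∫ x in cell s N q, F x| ≤ ∫ x in cube s, |F x| := by
  have hFa : IntegrableOn (fun x => |F x|) (cube s) := hF.abs
  calc _ ≤ ∑ q, ∫ x in cell s N q, |F x| :=
        Finset.sum_le_sum fun q _ => abs_integral_le_integral_abs
    _ = ∫ x in ⋃ q, cell s N q, |F x| :=
        (integral_iUnion_fintype (fun q => cell_measurable s N q) (cell_disjoint s N)
          fun q => hFa.mono_set (cell_subset s N hN q)).symm
    _ ≤ _ := by
        apply setIntegral_mono_set hFa (Filter.Eventually.of_forall fun x => abs_nonneg _)
        exact (iUnion_subset fun q => cell_subset s N hN q).eventuallyLE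

lemma final_ineq (s m N : ℕ) (hs : 1 ≤ s) (hN : 1 ≤ N) (α : ℝ) (hα0 : 0 < α) (L : ℝ) (hL : 0 < L)
    (hNL : (N : ℝ) ≤ 2 * (18 * L) ^ (1 / (s : ℝ))) (a : ℝ)
    (ha : a = (N : ℝ) ^ (-((m : ℝ) + α)) * ((4 : ℝ) ^ (m + 2)) ^ s /
      (2 * (s * (4 * ((m : ℝ) + 2))) ^ (m + 1))) :
    CL1 s m α / L ^ (((m : ℝ) + α) / s) ≤
      a * (((Nat.factorial (m + 2) : ℝ)) ^ 2 / (Nat.factorial (2 * (m + 2) + 1) : ℝ)) ^ s / 10 := by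
  have hs' : (1 : ℝ) ≤ s := by exact_mod_cast hs
  have hs0 : (0 : ℝ) < s := by linarith
  have hN0 : (0 : ℝ) < N := by exact_mod_cast hN
  set l : ℝ := (m : ℝ) + α with hl
  have hl0 : 0 < l := by positivity
  set X : ℝ := ((2 : ℝ) ^ l * (18 : ℝ) ^ (l / s) * L ^ (l / s))⁻¹ with hX
  have hX0 : 0 < X := by positivity
  have hNX : X ≤ (N : ℝ) ^ (-l) := by
    rw [Real.rpow_neg hN0.le, hX]
    apply inv_anti₀ (by positivity)
    calc (N : ℝ) ^ l ≤ (2 * (18 * L) ^ (1 / (s : ℝ))) ^ l := Real.rpow_le_rpow hN0.le hNL hl0.le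
      _ = _ := by
        rw [Real.mul_rpow (by norm_num) (by positivity), ← Real.rpow_mul (by positivity),
          show 1 / (s : ℝ) * l = l / s by ring, Real.mul_rpow (by norm_num) hL.le]; ring
  set B0 : ℝ := (Nat.factorial (m + 1) : ℝ) ^ 2 / (Nat.factorial (2 * m + 3) : ℝ) with hB0
  have hB0p : 0 < B0 := by
    have h1 := Nat.factorial_pos (m + 1)
    have h2 := Nat.factorial_pos (2 * m + 3)
    positivity
  have hB1 : B0 / 5 ≤ (Nat.factorial (m + 2) : ℝ) ^ 2 / (Nat.factorial (2 * (m + 2) + 1) : ℝ) := by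
    have h2 : (0 : ℝ) < Nat.factorial (2 * m + 3) := by exact_mod_cast Nat.factorial_pos (2 * m + 3)
    have h3 : (0 : ℝ) < Nat.factorial (m + 1) := by exact_mod_cast Nat.factorial_pos (m + 1)
    have e : (Nat.factorial (m + 2) : ℝ) ^ 2 / (Nat.factorial (2 * (m + 2) + 1) : ℝ)
        = B0 * (((m : ℝ) + 2) / (2 * (2 * m + 5))) := by
      rw [hB0, show 2 * (m + 2) + 1 = (2 * m + 3) + 1 + 1 by ring, Nat.factorial_succ (2 * m + 3 + 1),
        Nat.factorial_succ (2 * m + 3), Nat.factorial_succ (m + 1)]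
      push_cast
      field_simp
      ring
    rw [e, div_eq_mul_inv]
    apply mul_le_mul_of_nonneg_left _ hB0p.le
    rw [inv_eq_one_div, div_le_div_iff₀ (by norm_num) (by positivity)]
    linarith
  set E : ℝ := 1 + Real.exp 1 with hE
  have hE0 : (5 / 2 : ℝ) ≤ E := by have := Real.exp_one_gt_d9; linarith
  have hsq : 1 ≤ Real.sqrt s := Real.one_le_sqrt.2 hs'
  have hC : CL1 s m α / L ^ (l / s) = X * B0 ^ s /
      (20 * (Real.sqrt s * ((m : ℝ) + 1) ^ (m + 1) * E ^ (s * (m + 1)))) := by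
    have h2 : (0 : ℝ) < Nat.factorial (2 * m + 3) := by exact_mod_cast Nat.factorial_pos (2 * m + 3)
    rw [CL1, ← hl, ← hE, hX, hB0, Real.rpow_add (by norm_num), div_pow, pow_mul]
    norm_num
    field_simp
    try ring
  have hkey : (s * (4 * ((m : ℝ) + 2))) ^ (m + 1) * 5 ^ s ≤
      ((4 : ℝ) ^ (m + 2)) ^ s * (Real.sqrt s * ((m : ℝ) + 1) ^ (m + 1) * E ^ (s * (m + 1))) := by
    have k1 : (s : ℝ) * 4 ≤ 4 ^ s := by
      have : ∀ k : ℕ, ((k : ℝ) + 1) * 4 ≤ 4 ^ (k + 1) := by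
        intro k
        induction k with
        | zero => norm_num
        | succ k ih => rw [pow_succ]; push_cast; nlinarith [(Nat.cast_nonneg k : (0 : ℝ) ≤ k)]
      have h := this (s - 1)
      rw [Nat.sub_add_cancel hs] at h
      rw [Nat.cast_sub hs] at h
      push_cast at h
      linarith
    have k2 : (m : ℝ) + 2 ≤ 2 * (m + 1) := by linarith [(Nat.cast_nonneg m : (0 : ℝ) ≤ m)]
    have k3 : (2 : ℝ) ^ (m + 1) ≤ 2 ^ (s * (m + 1)) :=
      pow_le_pow_right₀ (by norm_num) (Nat.le_mul_of_pos_left _ hs)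
    have k4 : (5 : ℝ) ^ s ≤ 4 ^ s * (5 / 4) ^ (s * (m + 1)) := by
      have : (5 : ℝ) ^ s = 4 ^ s * (5 / 4) ^ s := by rw [← mul_pow]; norm_num
      rw [this]
      apply mul_le_mul_of_nonneg_left _ (by positivity)
      exact pow_le_pow_right₀ (by norm_num) (Nat.le_mul_of_pos_right _ (by omega))
    have k5 : (2 : ℝ) ^ (s * (m + 1)) * (5 / 4) ^ (s * (m + 1)) ≤ E ^ (s * (m + 1)) := by
      rw [← mul_pow]
      exact pow_le_pow_left₀ (by norm_num) (by linarith) _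
    calc (s * (4 * ((m : ℝ) + 2))) ^ (m + 1) * 5 ^ s
        ≤ (4 ^ s * (2 * ((m : ℝ) + 1))) ^ (m + 1) * (4 ^ s * (5 / 4) ^ (s * (m + 1))) := by
          apply mul_le_mul _ k4 (by positivity) (by positivity)
          apply pow_le_pow_left₀ (by positivity)
          rw [← mul_assoc]
          exact mul_le_mul k1 k2 (by positivity) (by positivity)
      _ = ((4 : ℝ) ^ (m + 2)) ^ s * (((m : ℝ) + 1) ^ (m + 1) * (2 ^ (m + 1) * (5 / 4) ^ (s * (m + 1)))) := by
          have : ((4 : ℝ) ^ (m + 2)) ^ s = (4 ^ s) ^ (m + 1) * 4 ^ s := by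
            rw [← pow_succ, ← pow_mul, ← pow_mul]; congr 1; ring
          rw [this, mul_pow, mul_pow]; ring
      _ ≤ ((4 : ℝ) ^ (m + 2)) ^ s * (((m : ℝ) + 1) ^ (m + 1) * E ^ (s * (m + 1))) := by
          have k6 : (2 : ℝ) ^ (m + 1) * (5 / 4) ^ (s * (m + 1)) ≤ E ^ (s * (m + 1)) :=
            (mul_le_mul_of_nonneg_right k3 (by positivity)).trans k5
          gcongr
      _ ≤ _ := by
          apply mul_le_mul_of_nonneg_left _ (by positivity)
          rw [mul_assoc]
          exact le_mul_of_one_le_left (by positivity) hsq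
  rw [hC]
  set U := (s * (4 * ((m : ℝ) + 2))) ^ (m + 1) with hU
  set V := Real.sqrt s * ((m : ℝ) + 1) ^ (m + 1) * E ^ (s * (m + 1)) with hV
  set W := ((4 : ℝ) ^ (m + 2)) ^ s with hW
  have hU0 : 0 < U := by positivity
  have hV0 : 0 < V := by positivity
  have hW0 : 0 < W := by positivity
  calc X * B0 ^ s / (20 * V) ≤ X * B0 ^ s * (W / (20 * U * 5 ^ s)) := by
        rw [div_eq_mul_one_div]
        apply mul_le_mul_of_nonneg_left _ (by positivity)
        rw [div_le_div_iff₀ (by positivity) (by positivity)]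
        linarith
    _ = (X * W / (2 * U)) * (B0 / 5) ^ s / 10 := by
        have e5 : (B0 / 5) ^ s = B0 ^ s / 5 ^ s := div_pow _ _ _
        rw [e5]
        generalize B0 ^ s = Z
        generalize (5 : ℝ) ^ s = Y5
        rw [mul_div_assoc', div_mul_div_comm, div_div]
        congr 1 <;> ring
    _ ≤ _ := by
        rw [ha]
        gcongr

/-- **Vitushkin-type lower bound in the L¹ norm with explicit constant.**
For any family `P(x,ζ) = Σ_{|k| ≤ d} c_k(x) ζ^k` with `L¹` coefficients on `I^s`,
there is `h ∈ Λ_l(I^s)` such that for every `ζ ∈ ℝⁿ`,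
`‖h − P(·,ζ)‖_{L¹(I^s)} ≥ C_{L¹}(l,s)/(n log d)^{l/s}`. -/
theorem stmt_1 (s m : ℕ) (hs : 1 ≤ s) (α : ℝ) (hα0 : 0 < α) (hα1 : α ≤ 1)
    (n d : ℕ) (hn : 1 ≤ n) (hd : 2 ≤ d)
    (c : (Fin n → ℕ) → EuclideanSpace ℝ (Fin s) → ℝ)
    (hc : ∀ k ∈ degSet n d, IntegrableOn (c k) (cube s)) :
    ∃ h : EuclideanSpace ℝ (Fin s) → ℝ, HolderClass s m α h ∧
      ∀ ζ : Fin n → ℝ,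
        CL1 s m α / ((n : ℝ) * Real.log d) ^ (((m:ℝ) + α) / s) ≤
          ∫ x in cube s, |h x - ∑ k ∈ degSet n d, c k x * ∏ i, ζ i ^ k i| := by
  have hd' : (2 : ℝ) ≤ d := by exact_mod_cast hd
  have hn' : (1 : ℝ) ≤ n := by exact_mod_cast hn
  have hs' : (1 : ℝ) ≤ s := by exact_mod_cast hs
  have hs0 : (0 : ℝ) < s := by linarith
  have hlogd : Real.log 2 ≤ Real.log d := Real.log_le_log (by norm_num) hd'
  have hlog2 := Real.log_two_gt_d9
  set L : ℝ := (n : ℝ) * Real.log d with hLdef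
  have hL1 : 1 ≤ 18 * L := by rw [hLdef]; nlinarith
  have hL0 : 0 < L := by linarith
  set T : ℝ := (18 * L) ^ (1 / (s : ℝ)) with hT
  have hT1 : 1 ≤ T := Real.one_le_rpow hL1 (by positivity)
  set N : ℕ := ⌈T⌉₊ with hNdef
  have hTN : T ≤ N := Nat.le_ceil T
  have hN1' : (1 : ℝ) ≤ N := hT1.trans hTN
  have hN1 : 1 ≤ N := by exact_mod_cast hN1'
  have hN0 : (0 : ℝ) < N := by linarith
  have hN2 : (N : ℝ) ≤ 2 * T := by
    have := Nat.ceil_lt_add_one (by linarith : 0 ≤ T)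
    linarith
  have hM : 18 * L ≤ ((N ^ s : ℕ) : ℝ) := by
    have h1 : T ^ s = 18 * L := by
      rw [hT, ← Real.rpow_natCast, ← Real.rpow_mul (by linarith)]
      rw [one_div, inv_mul_cancel₀ hs0.ne', Real.rpow_one]
    rw [← h1]; push_cast
    exact pow_le_pow_left₀ (by linarith) hTN _
  obtain ⟨a, ha⟩ : ∃ a : ℝ, a = (N : ℝ) ^ (-((m : ℝ) + α)) * ((4 : ℝ) ^ (m + 2)) ^ s /
      (2 * (s * (4 * ((m : ℝ) + 2))) ^ (m + 1)) := ⟨_, rfl⟩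
  have ha0 : 0 < a := by rw [ha]; positivity
  have hfin := final_ineq s m N hs hN1 α hα0 L hL0 hN2 a ha
  by_contra hcon
  push Not at hcon
  set Bt : ℝ := ((Nat.factorial (m + 2) : ℝ)) ^ 2 / (Nat.factorial (2 * (m + 2) + 1) : ℝ) with hBt
  have hBt0 : 0 < Bt := by
    have h1 := Nat.factorial_pos (m + 2)
    have h2 := Nat.factorial_pos (2 * (m + 2) + 1)
    positivity
  set b : ℝ := a * (Bt / N) ^ s with hb
  have hb0 : 0 < b := by positivity
  let p : (Fin s → Fin N) → MvPolynomial (Fin n) ℝ := fun q => ∑ k ∈ degSet n d,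
    MvPolynomial.monomial (Finsupp.equivFunOnFinite.symm k) ((∫ x in cell s N q, c k x) / b)
  have hpdeg : ∀ q, (p q).totalDegree ≤ d := by
    intro q
    refine MvPolynomial.totalDegree_finsetSum_le fun k hk => ?_
    refine (MvPolynomial.totalDegree_monomial_le _ _).trans ?_
    rw [Finsupp.sum_fintype _ _ (by simp)]
    simpa using (Finset.mem_filter.1 hk).2
  have hpeval : ∀ q ζ, MvPolynomial.eval ζ (p q)
      = (∑ k ∈ degSet n d, (∫ x in cell s N q, c k x) * ∏ i, ζ i ^ k i) / b := by
    intro q ζ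
    simp only [p, map_sum, MvPolynomial.eval_monomial]
    rw [Finset.sum_div]
    refine Finset.sum_congr rfl fun k _ => ?_
    rw [Finsupp.prod_fintype _ _ (by simp)]
    simp only [Finsupp.coe_equivFunOnFinite_symm]
    ring
  have hcore := core n d p hpdeg (by
    intro ε
    obtain ⟨ζ, hζ⟩ := hcon _ (hsum_holder s N m hs hN1 α hα0 hα1 ε a ha)
    refine ⟨ζ, ?_⟩
    have hPint : IntegrableOn (fun x => ∑ k ∈ degSet n d, c k x * ∏ i, ζ i ^ k i) (cube s) :=
      integrable_finsetSum _ fun k hk => (hc k hk).mul_const _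
    have hhint : IntegrableOn (fun x => a * hsum s N (m + 2) ε x) (cube s) :=
      ((hsum_contDiff s N (m + 1) ε).continuous.const_mul a |>.continuousOn).integrableOn_compact
        (cube_isCompact s)
    have hl1 := l1_cells s N hN1 _ (hhint.sub hPint)
    have hcell : ∀ q, ∫ x in cell s N q, ((fun x => a * hsum s N (m + 2) ε x) -
        (fun x => ∑ k ∈ degSet n d, c k x * ∏ i, ζ i ^ k i)) x
        = b * (sgn (ε q) - MvPolynomial.eval ζ (p q)) := by
      intro q
      have hsub := cell_subset s N hN1 q
      simp only [Pi.sub_apply]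
      rw [integral_sub (hhint.mono_set hsub) (hPint.mono_set hsub),
        integral_finsetSum _ fun k hk => ((hc k hk).mono_set hsub).mul_const _]
      have e1 : ∫ x in cell s N q, a * hsum s N (m + 2) ε x = b * sgn (ε q) := by
        rw [setIntegral_congr_fun (g := fun x => (a * sgn (ε q)) * phi s N (m + 2) q x)
          (cell_measurable s N q) (fun x hx => by
            simp only []
            rw [hsum_cell s N (m + 1) ε q x hx]; ring), integral_const_mul,
          integral_phi s N (m + 1) q, integral_bump (m + 1), hb]
        ring
      rw [e1, mul_sub, hpeval, mul_div_cancel₀ _ hb0.ne']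
      congr 1
      exact Finset.sum_congr rfl fun k _ => integral_mul_const _ _
    simp_rw [hcell, abs_mul, abs_of_pos hb0, ← Finset.mul_sum] at hl1
    have hcard : (Fintype.card (Fin s → Fin N) : ℝ) = (N : ℝ) ^ s := by simp
    have hab : a * Bt ^ s = b * (N : ℝ) ^ s := by
      have e6 : (Bt / N) ^ s = Bt ^ s / (N : ℝ) ^ s := div_pow _ _ _
      rw [hb, e6, mul_assoc, div_mul_cancel₀ _ (by positivity)]
    rw [hcard]
    have h1 : b * ∑ q, |sgn (ε q) - MvPolynomial.eval ζ (p q)| ≤ b * ((N : ℝ) ^ s / 10) := by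
      refine hl1.trans ((le_of_lt hζ).trans (hfin.trans (le_of_eq ?_)))
      rw [hab]; ring
    exact le_of_mul_le_mul_left h1 hb0)
  have hcardN : Fintype.card (Fin s → Fin N) = N ^ s := by simp
  rw [hcardN] at hcore
  exact absurd hcore (not_le.2 (numeric n d (N ^ s) hn hd hM))

end
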